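/- arXiv:1301.1195 — 3 statements merged into one kernel-verified Lean document; each statement's English description precedes it below -/
import Mathlib

section
/- Let R be a (not necessarily commutative) semiring, let a, b ∈ R, and let p₁, p₂, q₁, q₂ be polynomials with natural number coefficients. Then p₁(a)·(q₁(a)·q₂(b))·p₂(b) = q₁(a)·(p₁(a)·p₂(b))·q₂(b). In particular, in Protocol 2 Alice's key K_A and Bob's key K_B coincide. -/
/-- Evaluation of a natural-number polynomial at an element of a semiring. -/
noncomputable def natPolyEval {R : Type*} [Semiring R] (p : Polynomial ℕ) (a : R) : R :=
  Polynomial.eval₂ (Nat.castRingHom R) a p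

/-- Values of natural-number polynomials at the same element commute. -/
theorem natPolyEval_commute {R : Type*} [Semiring R] (p q : Polynomial ℕ) (a : R) :
    Commute (natPolyEval p a) (natPolyEval q a) :=
  (Commute.all p q).map (Polynomial.aeval (R := ℕ) a)

/-- In any semiring `R`, for `a b : R` and polynomials `p₁ p₂ q₁ q₂` with natural
number coefficients, `p₁(a) * (q₁(a) * q₂(b)) * p₂(b) = q₁(a) * (p₁(a) * p₂(b)) * q₂(b)`;
i.e. in Protocol 2 Alice's key and Bob's key coincide. -/
theorem stickel_protocol2_keys_agree {R : Type*} [Semiring R] (a b : R)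
    (p₁ p₂ q₁ q₂ : Polynomial ℕ) :
    natPolyEval p₁ a * (natPolyEval q₁ a * natPolyEval q₂ b) * natPolyEval p₂ b =
      natPolyEval q₁ a * (natPolyEval p₁ a * natPolyEval p₂ b) * natPolyEval q₂ b := by
  calc
    _ = (natPolyEval p₁ a * natPolyEval q₁ a) * (natPolyEval q₂ b * natPolyEval p₂ b) := by
      simp only [mul_assoc]
    _ = (natPolyEval q₁ a * natPolyEval p₁ a) * (natPolyEval p₂ b * natPolyEval q₂ b) := by
      rw [(natPolyEval_commute p₁ q₁ a).eq, (natPolyEval_commute q₂ p₂ b).eq]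
    _ = _ := by simp only [mul_assoc]
end

section
/- Given a 3-CNF Boolean formula presented as a finite list of clauses, each clause being a triple of literals (i, s) with variable index i and sign s ∈ Bool, the associated tropical polynomial system has a solution in the integers if and only if the formula is satisfiable. That is: there exist x, y : ι → ℤ such that x i + y i = 1 for every variable index i, and for every clause the minimum over its three literals of v (where v = y i for a positive literal (i, true) and v = x i for a negative literal (i, false)) equals 0, if and only if there exists an assignment u : ι → Bool such that every clause contains some literal (i, s) with u i = s. -/
/-- A 3-CNF clause: a triple of literals, each literal being a pair `(i, s)` of a
variable index and a sign (`true` = positive literal, `false` = negated literal). -/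
def Clause3 (ι : Type*) : Type _ := (ι × Bool) × (ι × Bool) × (ι × Bool)

/-- The value assigned to a literal by the tropical variables `x, y`:
`y i` for a positive literal `(i, true)` and `x i` for a negative literal `(i, false)`. -/
def litVal {ι : Type*} (x y : ι → ℤ) (l : ι × Bool) : ℤ :=
  if l.2 then y l.1 else x l.1

/-- An assignment `u` satisfies a clause if some literal `(i, s)` of it has `u i = s`. -/
def clauseSat {ι : Type*} (u : ι → Bool) (c : Clause3 ι) : Prop :=
  u c.1.1 = c.1.2 ∨ u c.2.1.1 = c.2.1.2 ∨ u c.2.2.1 = c.2.2.2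

/-- If `x i + y i = 1` for all `i`, the assignment `i ↦ (x i = 1)` makes every literal of
tropical value `0` true. -/
lemma decide_eq_of_litVal_eq_zero {ι : Type*} {x y : ι → ℤ} (hxy : ∀ i, x i + y i = 1)
    {l : ι × Bool} (hl : litVal x y l = 0) : decide (x l.1 = 1) = l.2 := by
  obtain ⟨i, _ | _⟩ := l
  · have hx : x i = 0 := by simpa [litVal] using hl
    simp [hx]
  · have hy : y i = 0 := by simpa [litVal] using hl
    simpa [hy] using hxy i

/-- For the tropical point associated to an assignment, a literal has value `0` if it is true
and `1` otherwise. -/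
lemma litVal_of_assignment {ι : Type*} (u : ι → Bool) (l : ι × Bool) :
    litVal (fun i => if u i then 1 else 0) (fun i => if u i then 0 else 1) l =
      if u l.1 = l.2 then 0 else 1 := by
  obtain ⟨i, _ | _⟩ := l <;> cases h : u i <;> simp [litVal, h]

/-- The tropical polynomial system associated to a 3-CNF formula (a list of clauses)
has an integer solution iff the formula is satisfiable: there exist `x y : ι → ℤ`
with `x i + y i = 1` for all `i` and, for each clause, the minimum over its three
literals of the corresponding value equals `0`, iff there is a satisfying assignment. -/
theorem tropical_system_solvable_iff_satisfiable {ι : Type*} [DecidableEq ι]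
    (F : List (Clause3 ι)) :
    (∃ x y : ι → ℤ, (∀ i, x i + y i = 1) ∧
        ∀ c ∈ F, min (litVal x y c.1) (min (litVal x y c.2.1) (litVal x y c.2.2)) = 0) ↔
      (∃ u : ι → Bool, ∀ c ∈ F, clauseSat u c) := by
  constructor
  · rintro ⟨x, y, hxy, hF⟩
    refine ⟨fun i => decide (x i = 1), fun c hc => ?_⟩
    have hmin := hF c hc
    have hzero : litVal x y c.1 = 0 ∨ litVal x y c.2.1 = 0 ∨ litVal x y c.2.2 = 0 := by omega
    exact hzero.imp (decide_eq_of_litVal_eq_zero hxy)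
      (Or.imp (decide_eq_of_litVal_eq_zero hxy) (decide_eq_of_litVal_eq_zero hxy))
  · rintro ⟨u, hu⟩
    refine ⟨fun i => if u i then 1 else 0, fun i => if u i then 0 else 1,
      fun i => by cases h : u i <;> simp [h], fun c hc => ?_⟩
    have hsat := hu c hc
    unfold clauseSat at hsat
    simp only [litVal_of_assignment]
    split_ifs <;> simp_all
end

section
/- A square matrix over the tropical min-plus semiring is invertible if and only if it is obtained from a diagonal matrix with finite diagonal entries by permuting rows: for a nonempty finite index type n, a matrix M : Matrix n n (Tropical (WithTop ℤ)) is a unit of the matrix semiring (there exists N with M ⊗ N = N ⊗ M = I) if and only if there exist a permutation σ of n and a function d : n → ℤ such that M i j equals the tropical element d i when j = σ i, and equals ⊤ (i.e. ∞) otherwise. -/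
theorem Tropical.sum_eq_zero_iff {ι R : Type*} [LinearOrder R] {s : Finset ι}
    {f : ι → Tropical (WithTop R)} : ∑ i ∈ s, f i = 0 ↔ ∀ i ∈ s, f i = 0 := by
  classical
  induction s using Finset.induction_on with
  | empty => simp
  | insert a s ha ih => simp [Finset.sum_insert ha, Tropical.add_eq_zero_iff, ih]

namespace Matrix

variable {n : Type*} [Fintype n] [DecidableEq n] {A B : Matrix n n (Tropical (WithTop ℤ))}

theorem exists_ne_zero_of_tropical_mul_eq_one (h : A * B = 1) (i : n) :
    ∃ k, A i k ≠ 0 ∧ B k i ≠ 0 := by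
  have hii : ∑ k, A i k * B k i ≠ 0 := by
    rw [← mul_apply, h, one_apply_eq]
    exact one_ne_zero
  obtain ⟨k, -, hk⟩ := Finset.exists_ne_zero_of_sum_ne_zero hii
  exact ⟨k, left_ne_zero_of_mul hk, right_ne_zero_of_mul hk⟩

theorem eq_of_tropical_mul_eq_one (h : A * B = 1) {i j k : n} (hA : A i k ≠ 0)
    (hB : B k j ≠ 0) : i = j := by
  by_contra hij
  have hsum : ∑ k, A i k * B k j = 0 := by rw [← mul_apply, h, one_apply_ne hij]
  exact mul_ne_zero hA hB (Tropical.sum_eq_zero_iff.mp hsum k (Finset.mem_univ k))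

end Matrix

/-- A square matrix over the tropical min-plus semiring `Tropical (WithTop ℤ)` is
invertible (has a two-sided inverse `N` with `M ⊗ N = N ⊗ M = I`) iff it is obtained
from a diagonal matrix with finite diagonal entries by a permutation: there are a
permutation `σ` and finite values `d i` with `M i j = d i` when `j = σ i` and
`M i j = ∞` (the tropical zero) otherwise. -/
theorem tropical_matrix_invertible_iff_permutation {n : Type*} [Fintype n] [DecidableEq n]
    [Nonempty n] (M : Matrix n n (Tropical (WithTop ℤ))) :
    (∃ N : Matrix n n (Tropical (WithTop ℤ)), M * N = 1 ∧ N * M = 1) ↔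
      ∃ (σ : Equiv.Perm n) (d : n → ℤ), ∀ i j,
        M i j = if j = σ i then Tropical.trop ((d i : ℤ) : WithTop ℤ)
          else Tropical.trop (⊤ : WithTop ℤ) := by
  constructor
  · rintro ⟨N, hMN, hNM⟩
    choose σ hMσ hNσ using Matrix.exists_ne_zero_of_tropical_mul_eq_one hMN
    have hinj : Function.Injective σ := fun i i' h =>
      Matrix.eq_of_tropical_mul_eq_one hMN (hMσ i) (h ▸ hNσ i')
    have hfinite (i : n) : ∃ d : ℤ, (d : WithTop ℤ) = Tropical.untrop (M i (σ i)) :=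
      WithTop.ne_top_iff_exists.mp fun h => hMσ i (Tropical.untrop_injective h)
    choose d hd using hfinite
    refine ⟨Equiv.ofBijective σ hinj.bijective_of_finite, d, fun i j => ?_⟩
    rw [Equiv.ofBijective_apply]
    split_ifs with hj
    · rw [hj, hd, Tropical.trop_untrop]
    · by_contra hM
      exact hj (Matrix.eq_of_tropical_mul_eq_one hNM (hNσ i) hM).symm
  · rintro ⟨σ, d, hM⟩
    have hcancel (i : n) :
        Tropical.trop (d i : WithTop ℤ) * Tropical.trop ((-d i : ℤ) : WithTop ℤ) = 1 := by
      rw [← Tropical.trop_add, ← WithTop.coe_add, add_neg_cancel, WithTop.coe_zero,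
        Tropical.trop_zero]
    refine ⟨.of fun j i => if j = σ i then Tropical.trop ((-d i : ℤ) : WithTop ℤ) else 0,
      ?_, ?_⟩
    · ext1 i j
      simp only [Matrix.mul_apply, Matrix.of_apply, hM, Tropical.trop_top, ite_mul, zero_mul,
        Finset.sum_ite_eq', Finset.mem_univ, if_true, Matrix.one_apply,
        σ.injective.eq_iff]
      split_ifs with hij
      · rw [← hij, hcancel]
      · rw [mul_zero]
    · ext1 i j
      obtain ⟨i, rfl⟩ := σ.surjective i
      simp only [Matrix.mul_apply, Matrix.of_apply, hM, Tropical.trop_top, ite_mul, zero_mul,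
        σ.injective.eq_iff, Finset.sum_ite_eq, Finset.mem_univ, if_true, Matrix.one_apply,
        eq_comm (a := j)]
      split_ifs
      · rw [mul_comm, hcancel]
      · rw [mul_zero]
end
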